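/- Let (Q, m, k) be a regular local ring of Krull dimension e whose residue field k is infinite. Let I ⊆ m² be an ideal minimally generated by f_1, ..., f_n, i.e., the images of f_1, ..., f_n form a k-basis of the k-vector space I/mI. Let d ≥ 2 satisfy I ⊆ m^d, let 1 ≤ c ≤ n, and assume that for all u_1, ..., u_c ∈ Q not all lying in m, the element u_1 f_1 + ... + u_c f_c does not lie in m^{d+1}. Then there exist t ≤ c and ideals J_1, ..., J_t of Q, each containing I and each generated by a regular sequence of length e on Q (so each Q/J_i is an artinian quotient of Q/I defined by a regular sequence), such that for all u_1, ..., u_c ∈ Q not all in m, there is an index i with u_1 f_1 + ... + u_c f_c ∉ mJ_i. Consequently, the image in the k-vector space I/mI of the set {g ∈ I : g ∈ mJ_i for all i = 1, ..., t} is a k-subspace of dimension at most n − c. -/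

import Mathlib

open IsLocalRing

/-- A Noetherian local ring is regular if its maximal ideal can be generated by
`dim Q` elements. -/
def IsRegularLocal (Q : Type*) [CommRing Q] [IsLocalRing Q] [IsNoetherianRing Q] : Prop :=
  ∃ (n : ℕ) (x : Fin n → Q),
    Ideal.span (Set.range x) = maximalIdeal Q ∧ ringKrullDim Q = n

section RegularLocal

variable {R : Type*} [CommRing R] [IsLocalRing R]

lemma isLocalRing_quotient_span_singleton {x : R} (hx : x ∈ maximalIdeal R) :
    IsLocalRing (R ⧸ Ideal.span {x}) := by
  have : Nontrivial (R ⧸ Ideal.span {x}) := Ideal.Quotient.nontrivial_iff.mpr fun h =>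
    (maximalIdeal.isMaximal R).ne_top
      (top_le_iff.mp (h ▸ (Ideal.span_singleton_le_iff_mem _).mpr hx))
  exact .of_surjective' (Ideal.Quotient.mk _) Ideal.Quotient.mk_surjective

lemma map_mk_maximalIdeal_eq {x : R} [IsLocalRing (R ⧸ Ideal.span {x})] {n : ℕ} {y : Fin n → R}
    (h : Ideal.span {x} ⊔ Ideal.span (Set.range y) = maximalIdeal R) :
    Ideal.span (Set.range (Ideal.Quotient.mk (Ideal.span {x}) ∘ y)) =
      maximalIdeal (R ⧸ Ideal.span {x}) := by
  rw [← IsLocalRing.map_maximalIdeal_of_surjective (Ideal.Quotient.mk (Ideal.span {x}))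
    Ideal.Quotient.mk_surjective, ← h, Ideal.map_sup, Ideal.map_quotient_self, bot_sup_eq,
    Ideal.map_span, Set.range_comp]

lemma ringKrullDim_quotient_span_singleton_of_span_sup_eq [IsNoetherianRing R] {x : R} {n : ℕ} {y : Fin n → R}
    (h : Ideal.span {x} ⊔ Ideal.span (Set.range y) = maximalIdeal R)
    (hdim : ringKrullDim R = (n + 1 : ℕ)) : ringKrullDim (R ⧸ Ideal.span {x}) = n := by
  have hx : x ∈ maximalIdeal R := h ▸ Ideal.mem_sup_left (Ideal.mem_span_singleton_self x)
  have := isLocalRing_quotient_span_singleton hx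
  apply le_antisymm
  · refine (ringKrullDim_le_spanFinrank_maximalIdeal _).trans ?_
    rw [← map_mk_maximalIdeal_eq h]
    have := Submodule.spanFinrank_span_le_ncard_of_finite (R := R ⧸ Ideal.span {x})
      (Set.finite_range (Ideal.Quotient.mk (Ideal.span {x}) ∘ y))
    have h2 : (Set.range (Ideal.Quotient.mk (Ideal.span {x}) ∘ y)).ncard ≤ n := by
      rw [← Set.image_univ]
      exact (Set.ncard_image_le Set.finite_univ).trans (by simp)
    exact_mod_cast this.trans h2
  · have := ringKrullDim_le_ringKrullDim_quotient_add_encard {x}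
      (by simpa using IsLocalRing.ringJacobson_eq_maximalIdeal R ▸ hx)
    rw [hdim] at this
    simp only [Set.encard_singleton, Nat.cast_add, Nat.cast_one] at this
    exact (ENat.WithBot.add_le_add_one_right_iff).mp this

lemma exists_span_sup_span_eq_maximalIdeal {n : ℕ} {y : Fin (n + 1) → R}
    (h : Ideal.span (Set.range y) = maximalIdeal R) {x : R} (hx : x ∈ maximalIdeal R)
    (hx2 : x ∉ maximalIdeal R ^ 2) :
    ∃ z : Fin n → R, Ideal.span {x} ⊔ Ideal.span (Set.range z) = maximalIdeal R := by
  have hy (i) : y i ∈ maximalIdeal R := h ▸ Ideal.subset_span ⟨i, rfl⟩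
  obtain ⟨a, rfl⟩ := (Ideal.mem_span_range_iff_exists_fun).mp (h ▸ hx)
  obtain ⟨l, hl⟩ : ∃ l, IsUnit (a l) := by
    by_contra! hc
    refine hx2 (Ideal.sum_mem _ fun i _ => ?_)
    rw [pow_two]
    exact Ideal.mul_mem_mul (hc i) (hy i)
  refine ⟨y ∘ l.succAbove, le_antisymm (sup_le ?_ ?_) ?_⟩
  · exact (Ideal.span_singleton_le_iff_mem _).mpr hx
  · rw [Ideal.span_le]
    rintro _ ⟨i, rfl⟩
    exact hy _
  · have hs (j) : y (l.succAbove j) ∈ Ideal.span {∑ i, a i * y i} ⊔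
        Ideal.span (Set.range (y ∘ l.succAbove)) :=
      Ideal.mem_sup_right (Ideal.subset_span ⟨j, rfl⟩)
    rw [← h, Ideal.span_le]
    rintro _ ⟨i, rfl⟩
    obtain rfl | ⟨j, rfl⟩ := l.eq_self_or_eq_succAbove i
    · rw [SetLike.mem_coe, ← Ideal.unit_mul_mem_iff_mem _ hl,
        eq_sub_of_add_eq (Fin.sum_univ_succAbove (fun i => a i * y i) i).symm]
      exact Ideal.sub_mem _ (Ideal.mem_sup_left (Ideal.mem_span_singleton_self _))
        (Ideal.sum_mem _ fun j _ => Ideal.mul_mem_left _ _ (hs j))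
    · exact hs j

end RegularLocal

theorem isDomain_of_span_range_eq_maximalIdeal (n : ℕ) :
    ∀ {R : Type*} [CommRing R] [IsLocalRing R] [IsNoetherianRing R] (y : Fin n → R),
      Ideal.span (Set.range y) = maximalIdeal R → ringKrullDim R = n → IsDomain R := by
  induction n with
  | zero =>
    intro R _ _ _ y h _
    have : IsField R := by
      rw [IsLocalRing.isField_iff_maximalIdeal_eq, ← h]
      simp
    exact this.isDomain
  | succ n ih =>
    intro R _ _ _ y h hdim
    have hmin : ∀ p ∈ minimalPrimes R, ¬ maximalIdeal R ≤ p := by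
      intro p hp hle
      have := hp.1.1
      have hpm : p = maximalIdeal R := (le_maximalIdeal this.ne_top).antisymm hle
      have h0 : (maximalIdeal R).height = 0 := by
        rw [← hpm]
        exact Ideal.height_eq_zero_iff.mpr hp
      rw [← maximalIdeal_height_eq_ringKrullDim, h0] at hdim
      norm_cast at hdim
    have hsq : ¬ maximalIdeal R ≤ maximalIdeal R ^ 2 := by
      refine ((maximalIdeal_sq_lt_maximalIdeal R).mpr ?_).not_ge
      intro hf
      rw [ringKrullDim_eq_zero_of_isField hf] at hdim
      norm_cast at hdim
    obtain ⟨x, hx, hx2, hxp⟩ : ∃ x ∈ maximalIdeal R, x ∉ maximalIdeal R ^ 2 ∧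
        ∀ p ∈ minimalPrimes R, x ∉ p := by
      classical
      by_contra! hc
      have hfin := minimalPrimes.finite_of_isNoetherianRing R
      have := (Ideal.subset_union_prime (s := insert (maximalIdeal R ^ 2) hfin.toFinset)
        (f := id) (I := maximalIdeal R) (maximalIdeal R ^ 2) (maximalIdeal R ^ 2) (by
          intro i hi hne _
          rcases Finset.mem_insert.mp hi with h | h
          · exact absurd h hne
          · exact (hfin.mem_toFinset.mp h).1.1)).mp (by
          intro x hx
          by_cases hx2 : x ∈ maximalIdeal R ^ 2
          · simp [hx2]
          · obtain ⟨p, hp, hxp⟩ := hc x hx hx2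
            simp only [Set.mem_iUnion]
            exact ⟨p, by simp [hp], hxp⟩)
      obtain ⟨i, hi, hle⟩ := this
      rcases Finset.mem_insert.mp hi with rfl | h
      · exact hsq hle
      · exact hmin i (hfin.mem_toFinset.mp h) hle
    obtain ⟨z, hz⟩ := exists_span_sup_span_eq_maximalIdeal h hx hx2
    have hdim' := ringKrullDim_quotient_span_singleton_of_span_sup_eq hz hdim
    have := isLocalRing_quotient_span_singleton hx
    have hprime := (Ideal.Quotient.isDomain_iff_prime _).mp
      (ih _ (map_mk_maximalIdeal_eq hz) hdim')
    obtain ⟨q, hq, hqx⟩ := Ideal.exists_minimalPrimes_le (I := ⊥) (J := Ideal.span {x}) bot_le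
    have hqp := hq.1.1
    have hq0 : q = ⊥ := by
      refine Submodule.eq_bot_of_le_smul_of_le_jacobson_bot (Ideal.span {x}) q
        (IsNoetherian.noetherian q) ?_ ?_
      · intro w hw
        obtain ⟨a, rfl⟩ := Ideal.mem_span_singleton'.mp (hqx hw)
        rw [mul_comm a x]
        exact Ideal.mul_mem_mul (Ideal.mem_span_singleton_self x)
          ((hqp.mem_or_mem hw).resolve_right (hxp q hq))
      · rw [IsLocalRing.jacobson_eq_maximalIdeal _ bot_ne_top]
        exact (Ideal.span_singleton_le_iff_mem _).mpr hx
    rw [hq0] at hqp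
    exact IsDomain.of_bot_isPrime R

open RingTheory.Sequence in
theorem isWeaklyRegular_ofFn_of_span_range_eq_maximalIdeal (n : ℕ) :
    ∀ {R : Type*} [CommRing R] [IsLocalRing R] [IsNoetherianRing R] (y : Fin n → R),
      Ideal.span (Set.range y) = maximalIdeal R → ringKrullDim R = n →
      IsWeaklyRegular R (List.ofFn y) := by
  induction n with
  | zero =>
    intro R _ _ _ y _ _
    simp
  | succ n ih =>
    intro R _ _ _ y h hdim
    have hdom := isDomain_of_span_range_eq_maximalIdeal _ y h hdim
    have hsup : Ideal.span {y 0} ⊔ Ideal.span (Set.range (y ∘ Fin.succ)) = maximalIdeal R := by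
      rw [← h, ← Ideal.span_union, Fin.range_fin_succ]
      rfl
    have hx : y 0 ∈ maximalIdeal R := h ▸ Ideal.subset_span ⟨0, rfl⟩
    have hdim' := ringKrullDim_quotient_span_singleton_of_span_sup_eq hsup hdim
    have := isLocalRing_quotient_span_singleton hx
    rw [List.ofFn_succ, isWeaklyRegular_cons_iff]
    constructor
    · refine (IsRegular.of_ne_zero fun h0 => ?_).left.isSMulRegular
      rw [h0] at hdim'
      have hb : Ideal.span {(0 : R)} = ⊥ := by simp
      rw [hb, ringKrullDim_eq_of_ringEquiv (RingEquiv.quotientBot R), hdim] at hdim'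
      norm_cast at hdim'
      omega
    · have e : QuotSMulTop (y 0) R ≃ₗ[R] R ⧸ Ideal.span {y 0} :=
        Submodule.quotEquivOfEq _ _ (by simp [← Submodule.ideal_span_singleton_smul])
      rw [e.isWeaklyRegular_congr, ← isWeaklyRegular_map_algebraMap_iff (R ⧸ Ideal.span {y 0}),
        List.map_ofFn]
      exact ih _ (map_mk_maximalIdeal_eq hsup) hdim'

section Forms

variable {R : Type*} [CommRing R]

lemma MvPolynomial.IsHomogeneous.eval_mul_left {σ : Type*} {d : ℕ} {F : MvPolynomial σ R}
    (hF : F.IsHomogeneous d) (a : R) (x : σ → R) :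
    MvPolynomial.eval (fun i => a * x i) F = a ^ d * MvPolynomial.eval x F := by
  simp only [MvPolynomial.eval_eq, Finset.mul_sum]
  refine Finset.sum_congr rfl fun s hs => ?_
  rw [hF.degree_eq_sum_deg_support hs, ← Finset.prod_pow_eq_pow_sum]
  simp only [mul_pow, Finset.prod_mul_distrib]
  ring

lemma MvPolynomial.IsHomogeneous.eval_mem_mul_pow {σ : Type*} {d : ℕ} {F : MvPolynomial σ R}
    (hF : F.IsHomogeneous d) {I : Ideal R} {x : σ → R} (hx : ∀ i, x i ∈ I)
    (hI : ∀ s, F.coeff s ∈ I) : MvPolynomial.eval x F ∈ I ^ (d + 1) := by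
  rw [MvPolynomial.eval_eq]
  refine Ideal.sum_mem _ fun s hs => ?_
  rw [pow_succ', hF.degree_eq_sum_deg_support hs, ← Finset.prod_pow_eq_pow_sum]
  exact Ideal.mul_mem_mul (hI s)
    (Ideal.prod_mem_prod fun i _ => Ideal.pow_mem_pow (hx i) _)

lemma Ideal.sup_pow_le_sup_pow (I J : Ideal R) (d : ℕ) : (I ⊔ J) ^ d ≤ I ⊔ J ^ d := by
  induction d with
  | zero => simp
  | succ d ih =>
    rw [pow_succ, pow_succ]
    refine (Ideal.mul_mono_left ih).trans ?_
    rw [Ideal.sup_mul, Ideal.mul_sup (J ^ d)]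
    exact sup_le (Ideal.mul_le_left.trans le_sup_left)
      (sup_le (Ideal.mul_le_right.trans le_sup_left) le_sup_right)

end Forms

section Point

variable {R : Type*} [CommRing R] [IsLocalRing R]

lemma isArtinianRing_quotient_of_maximalIdeal_pow_le [IsNoetherianRing R] {J : Ideal R} {d : ℕ}
    (h : maximalIdeal R ^ d ≤ J) : IsArtinianRing (R ⧸ J) := by
  rcases subsingleton_or_nontrivial (R ⧸ J) with _ | _
  · infer_instance
  have : IsLocalRing (R ⧸ J) :=
    .of_surjective' (Ideal.Quotient.mk _) Ideal.Quotient.mk_surjective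
  rw [isArtinianRing_iff_isNilpotent_maximalIdeal]
  refine ⟨d, ?_⟩
  rw [← IsLocalRing.map_maximalIdeal_of_surjective (Ideal.Quotient.mk J)
    Ideal.Quotient.mk_surjective, ← Ideal.map_pow, Ideal.zero_eq_bot, Ideal.map_eq_bot_iff_le_ker,
    Ideal.mk_ker]
  exact h

open RingTheory.Sequence

/-- The ideal generated by the linear forms vanishing at a point `p` with `p l` a unit, together
with the `d`-th power of the `l`-th coordinate. A form of degree `d` evaluates into `𝔪` times this
ideal only if it vanishes at the residue of `p`. -/
theorem exists_isRegular_of_isUnit_apply [IsNoetherianRing R] {e : ℕ} {x : Fin e → R}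
    (hx : Ideal.span (Set.range x) = maximalIdeal R) (hdim : ringKrullDim R = e)
    (p : Fin e → R) {l : Fin e} (hl : IsUnit (p l)) {d : ℕ} (hd : d ≠ 0) :
    ∃ r : Fin e → R, IsRegular R (List.ofFn r) ∧
      maximalIdeal R ^ d ≤ Ideal.span (Set.range r) ∧
      ∀ F : MvPolynomial (Fin e) R, F.IsHomogeneous d →
        MvPolynomial.eval x F ∈ maximalIdeal R * Ideal.span (Set.range r) →
        MvPolynomial.eval p F ∈ maximalIdeal R := by
  obtain _ | e := e
  · exact l.elim0
  have hxm (i) : x i ∈ maximalIdeal R := hx ▸ Ideal.subset_span ⟨i, rfl⟩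
  set y : Fin e → R := fun j => p l * x (l.succAbove j) - p (l.succAbove j) * x l with hy
  set Y := Ideal.span (Set.range y) with hY
  have hym (j) : y j ∈ maximalIdeal R :=
    sub_mem (Ideal.mul_mem_left _ _ (hxm _)) (Ideal.mul_mem_left _ _ (hxm _))
  have hspan (a : R) : Ideal.span (Set.range (Fin.snoc y a : Fin (e + 1) → R)) =
      Y ⊔ Ideal.span {a} := by
    rw [Fin.range_snoc, Ideal.span_insert, sup_comm]
  have hm : Y ⊔ Ideal.span {x l} = maximalIdeal R := by
    refine le_antisymm (sup_le ?_ ((Ideal.span_singleton_le_iff_mem _).mpr (hxm l))) ?_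
    · rw [hY, Ideal.span_le]
      rintro _ ⟨j, rfl⟩
      exact hym j
    · rw [← hx, Ideal.span_le]
      rintro _ ⟨i, rfl⟩
      have hxl : x l ∈ Y ⊔ Ideal.span {x l} :=
        Ideal.mem_sup_right (Ideal.mem_span_singleton_self _)
      obtain rfl | ⟨j, rfl⟩ := l.eq_self_or_eq_succAbove i
      · exact hxl
      · rw [SetLike.mem_coe, ← Ideal.unit_mul_mem_iff_mem _ hl,
          ← sub_add_cancel (p l * x (l.succAbove j)) (p (l.succAbove j) * x l)]
        exact add_mem (Ideal.mem_sup_left (Ideal.subset_span ⟨j, rfl⟩))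
          (Ideal.mul_mem_left _ _ hxl)
  have hlist : (Ideal.ofList (List.ofFn y) • ⊤ : Ideal R) = Y := by
    simp [Ideal.ofList, hY, Set.range, List.mem_ofFn]
  have hofFn (a : R) : List.ofFn (Fin.snoc y a : Fin (e + 1) → R) = List.ofFn y ++ [a] := by
    simp [List.ofFn_succ_last, -List.ofFn_succ]
  have hreg := isWeaklyRegular_ofFn_of_span_range_eq_maximalIdeal (e + 1)
    (Fin.snoc y (x l) : Fin (e + 1) → R) (by rw [hspan, hm]) hdim
  rw [hofFn, isWeaklyRegular_append_iff, isWeaklyRegular_singleton_iff] at hreg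
  have hpow := hreg.2.pow d
  refine ⟨Fin.snoc y (x l ^ d), ?_, ?_, ?_⟩
  · rw [hofFn]
    refine .of_isWeaklyRegular_of_mem_maximalIdeal _ ?_ ?_
    · intro r hr
      rcases List.mem_append.mp hr with hr | hr
      · obtain ⟨j, rfl⟩ := List.mem_ofFn.mp hr
        exact hym j
      · rw [List.mem_singleton.mp hr]
        exact Ideal.pow_mem_of_mem _ (hxm l) _ (Nat.pos_of_ne_zero hd)
    · rw [isWeaklyRegular_append_iff, isWeaklyRegular_singleton_iff]
      exact ⟨hreg.1, hpow⟩
  · rw [hspan, ← hm, ← Ideal.span_singleton_pow]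
    exact Ideal.sup_pow_le_sup_pow _ _ _
  · intro F hF hmem
    by_contra hp
    have hp : IsUnit (MvPolynomial.eval p F) := by simpa using hp
    rw [hspan, Ideal.mul_sup] at hmem
    obtain ⟨u, hu, v, hv, huv⟩ := Submodule.mem_sup.mp hmem
    obtain ⟨a, ha, rfl⟩ := Ideal.mem_mul_span_singleton.mp hv
    replace hu : u ∈ Y := Ideal.mul_le_right hu
    have hcoord : ∀ i, Ideal.Quotient.mk Y (p l * x i) = Ideal.Quotient.mk Y (x l * p i) := by
      intro i
      rw [Ideal.Quotient.eq]
      obtain rfl | ⟨j, rfl⟩ := l.eq_self_or_eq_succAbove i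
      · rw [mul_comm, sub_self]
        exact zero_mem _
      · rw [mul_comm (x l)]
        exact Ideal.subset_span ⟨j, rfl⟩
    have heval : p l ^ d * MvPolynomial.eval x F - x l ^ d * MvPolynomial.eval p F ∈ Y := by
      rw [← Ideal.Quotient.eq, ← hF.eval_mul_left, ← hF.eval_mul_left,
        MvPolynomial.eval, MvPolynomial.map_eval₂Hom, MvPolynomial.eval, MvPolynomial.map_eval₂Hom]
      simp only [hcoord]
    have hunit : IsUnit (p l ^ d * a - MvPolynomial.eval p F) := by
      by_contra hc
      have h1 : MvPolynomial.eval p F ∈ maximalIdeal R := by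
        rw [← sub_sub_cancel (p l ^ d * a) (MvPolynomial.eval p F)]
        exact sub_mem (Ideal.mul_mem_left _ _ ha) hc
      exact h1 hp
    have hxY : x l ^ d ∈ Y := by
      rw [← Ideal.unit_mul_mem_iff_mem _ hunit]
      have h2 : (p l ^ d * a - MvPolynomial.eval p F) * x l ^ d =
          (p l ^ d * MvPolynomial.eval x F - x l ^ d * MvPolynomial.eval p F) - p l ^ d * u := by
        rw [← huv]
        ring
      rw [h2]
      exact sub_mem heval (Ideal.mul_mem_left _ _ hu)
    have h1 : (1 : R) ∈ Y := by
      rw [hlist] at hpow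
      rw [← Ideal.Quotient.eq_zero_iff_mem]
      refine hpow ?_
      change x l ^ d • Ideal.Quotient.mk Y 1 = x l ^ d • 0
      rw [smul_zero, ← Ideal.Quotient.mk_eq_mk, ← Submodule.Quotient.mk_smul, smul_eq_mul, mul_one]
      exact (Submodule.Quotient.mk_eq_zero _).mpr hxY
    exact (maximalIdeal.isMaximal R).ne_top
      ((Ideal.eq_top_iff_one _).mpr (hm ▸ Ideal.mem_sup_left h1))

end Point

theorem exists_points_of_linearIndependent_functions {k X : Type*} [Field k] {c : ℕ}
    (G : Fin c → X → k) (hG : ∀ u : Fin c → k, (∀ x, ∑ j, u j * G j x = 0) → u = 0) :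
    ∃ p : Fin c → X, (∀ i, ∃ j, G j (p i) ≠ 0) ∧
      ∀ u : Fin c → k, (∀ i, ∑ j, u j * G j (p i) = 0) → u = 0 := by
  set S : Set (Fin c → k) := Set.range fun x j => G j x
  have hS : Submodule.span k S = ⊤ := by
    by_contra hne
    obtain ⟨φ, hφ, hle⟩ := Submodule.exists_le_ker_of_lt_top _ (lt_top_iff_ne_top.mpr hne)
    have hφ' (v : Fin c → k) : φ v = ∑ j, φ (Pi.single j 1) * v j := by
      conv_lhs => rw [pi_eq_sum_univ' v]
      simp [mul_comm, Pi.single]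
    have h0 := hG (fun j => φ (Pi.single j 1)) fun x =>
      (hφ' _).symm.trans (hle (Submodule.subset_span ⟨x, rfl⟩))
    refine hφ (LinearMap.ext fun v => ?_)
    rw [hφ', LinearMap.zero_apply]
    exact Finset.sum_eq_zero fun j _ => by rw [congrFun h0 j, Pi.zero_apply, zero_mul]
  obtain ⟨v, hvS, hspan, hli⟩ := Submodule.exists_fun_fin_finrank_span_eq k S
  have hc : Module.finrank k (Submodule.span k S) = c := by
    rw [hS, finrank_top, Module.finrank_fin_fun]
  replace hspan := hspan.trans hS
  generalize Module.finrank k (Submodule.span k S) = c' at v hvS hspan hli hc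
  subst hc
  choose p hp using hvS
  refine ⟨p, fun i => ?_, fun u hu => ?_⟩
  · by_contra! h0
    exact hli.ne_zero i ((hp i).symm.trans (funext h0))
  · refine dotProduct_eq_zero u fun w => ?_
    have hw : w ∈ Submodule.span k (Set.range v) := hspan ▸ Submodule.mem_top
    induction hw using Submodule.span_induction with
    | mem w hw =>
      obtain ⟨i, rfl⟩ := hw
      rw [← hp i]
      exact hu i
    | zero => simp
    | add a b _ _ ha hb => rw [dotProduct_add, ha, hb, add_zero]
    | smul t a _ ha => rw [dotProduct_smul, ha, smul_zero]

/-- A family of vectors spanning the kernel of a matrix whose restriction to some square block of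
columns is injective. -/
theorem exists_fin_basis_of_injective_submatrix {k : Type*} [Field k] {c n : ℕ} (g : Fin c → Fin n)
    (hg : Function.Injective g) (M : Fin c → Fin n → k)
    (hM : ∀ u : Fin c → k, (∀ i, ∑ j, u j * M i (g j) = 0) → u = 0) :
    ∃ B : Fin (n - c) → Fin n → k, ∀ b : Fin n → k, (∀ i, ∑ j, b j * M i j = 0) →
      ∃ a : Fin (n - c) → k, ∀ i, b i = ∑ j, a j * B j i := by
  let E : (Fin n → k) →ₗ[k] (Fin c → k) := (Matrix.of M).mulVecLin
  have hE (b : Fin n → k) (i) : E b i = ∑ j, b j * M i j := by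
    simp [E, Matrix.mulVec, dotProduct, mul_comm]
  let E' : (Fin c → k) →ₗ[k] (Fin c → k) := (Matrix.of fun i j => M i (g j)).mulVecLin
  have hE' (b : Fin c → k) (i) : E' b i = ∑ j, b j * M i (g j) := by
    simp [E', Matrix.mulVec, dotProduct, mul_comm]
  have hinj : Function.Injective E' := by
    rw [injective_iff_map_eq_zero]
    exact fun u hu => hM u fun i => (hE' u i).symm.trans (congrFun hu i)
  have hsurj : Function.Surjective E := by
    intro v
    obtain ⟨u, rfl⟩ := LinearMap.injective_iff_surjective.mp hinj v
    refine ⟨Function.extend g u 0, funext fun i => ?_⟩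
    rw [hE, hE']
    refine (Fintype.sum_of_injective g hg _ _ (fun j hj => ?_) fun j => ?_).symm
    · rw [Function.extend_apply' _ _ _ hj, Pi.zero_apply, zero_mul]
    · rw [hg.extend_apply]
  have hker : Module.finrank k (LinearMap.ker E) = n - c := by
    have := LinearMap.finrank_range_add_finrank_ker E
    rw [LinearMap.range_eq_top.mpr hsurj, finrank_top, Module.finrank_fin_fun,
      Module.finrank_fin_fun] at this
    omega
  let B := Module.finBasisOfFinrankEq k (LinearMap.ker E) hker
  refine ⟨fun j => (B j).1, fun b hb => ?_⟩
  let b' : LinearMap.ker E := ⟨b, funext fun i => (hE b i).trans (hb i)⟩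
  refine ⟨B.repr b', fun i => ?_⟩
  have h := congrFun (congrArg (LinearMap.ker E).subtype (B.sum_repr b')) i
  rw [map_sum, Finset.sum_apply] at h
  exact h.symm

/-- **Main construction (from the proof of Theorem 3.7).**  Let `(Q,𝔪,k)` be a regular local
ring of Krull dimension `e` with infinite residue field, and `I ⊆ 𝔪²` an ideal minimally
generated by `f_1, …, f_n`.  Let `d ≥ 2` with `I ⊆ 𝔪^d` and `1 ≤ c ≤ n`, and assume that
every combination `u_1 f_1 + ⋯ + u_c f_c` with some `u_i` a unit lies outside `𝔪^{d+1}`.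
Then there are `t ≤ c` ideals `J_1, …, J_t ⊇ I`, each generated by a `Q`-regular sequence of
length `e` (so each `Q/J_i` is artinian), such that every such combination lies outside
`𝔪J_i` for some `i`; consequently the image in `I/𝔪I` of
`{g ∈ I : g ∈ 𝔪J_i for all i}` is a subspace of dimension at most `n - c`. -/
theorem stmt5 (Q : Type*) [CommRing Q] [IsLocalRing Q] [IsNoetherianRing Q]
    (hreg : IsRegularLocal Q)
    (e : ℕ) (hdim : ringKrullDim Q = e)
    [Infinite (ResidueField Q)]
    (n : ℕ) (f : Fin n → Q) (I : Ideal Q)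
    (hI2 : I ≤ maximalIdeal Q ^ 2)
    (hgen : Ideal.span (Set.range f) = I)
    (hminimal : ∀ u : Fin n → Q,
      (∑ i, u i * f i) ∈ maximalIdeal Q * I → ∀ i, u i ∈ maximalIdeal Q)
    (d : ℕ) (hd : 2 ≤ d) (hId : I ≤ maximalIdeal Q ^ d)
    (c : ℕ) (hc1 : 1 ≤ c) (hcn : c ≤ n)
    (horder : ∀ u : Fin c → Q, (∃ i, u i ∉ maximalIdeal Q) →
      (∑ i, u i * f (Fin.castLE hcn i)) ∉ maximalIdeal Q ^ (d + 1)) :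
    ∃ (t : ℕ), t ≤ c ∧ ∃ J : Fin t → Ideal Q,
      (∀ i, I ≤ J i) ∧
      (∀ i, ∃ r : Fin e → Q, RingTheory.Sequence.IsRegular Q (List.ofFn r) ∧
        Ideal.span (Set.range r) = J i) ∧
      (∀ i, IsArtinianRing (Q ⧸ J i)) ∧
      (∀ u : Fin c → Q, (∃ i, u i ∉ maximalIdeal Q) →
        ∃ i, (∑ j, u j * f (Fin.castLE hcn j)) ∉ maximalIdeal Q * J i) ∧
      (∃ w : Fin (n - c) → Q, (∀ j, w j ∈ I) ∧
        ∀ g ∈ I, (∀ i, g ∈ maximalIdeal Q * J i) →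
          ∃ a : Fin (n - c) → Q, g - ∑ j, a j * w j ∈ maximalIdeal Q * I) := by
  set m := maximalIdeal Q with hm
  set φ := residue Q with hφ
  have hφm (a : Q) : φ a = 0 ↔ a ∈ m := residue_eq_zero_iff a
  obtain ⟨e', x, hx, hdim'⟩ := hreg
  obtain rfl : e' = e := by
    rw [hdim] at hdim'
    exact_mod_cast hdim'.symm
  have hxm (i) : x i ∈ m := hm ▸ hx ▸ Ideal.subset_span ⟨i, rfl⟩
  have hfI (i) : f i ∈ I := hgen ▸ Ideal.subset_span ⟨i, rfl⟩
  choose F hF hFf using fun i =>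
    (Ideal.mem_span_pow_iff_exists_isHomogeneous x (f i)).mp (by rw [hx]; exact hId (hfI i))
  have hcomb {s : ℕ} (g : Fin s → Fin n) (b : Fin s → Q) :
      (∑ j, MvPolynomial.C (b j) * F (g j)).IsHomogeneous d :=
    MvPolynomial.IsHomogeneous.sum _ _ _ fun j _ => by
      simpa using (MvPolynomial.isHomogeneous_C _ (b j)).mul (hF (g j))
  have hcombx {s : ℕ} (g : Fin s → Fin n) (b : Fin s → Q) :
      MvPolynomial.eval x (∑ j, MvPolynomial.C (b j) * F (g j)) = ∑ j, b j * f (g j) := by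
    simp [hFf]
  have hmapeval (q : Fin e' → Q) (H : MvPolynomial (Fin e') Q) :
      MvPolynomial.eval (φ ∘ q) (MvPolynomial.map φ H) = φ (MvPolynomial.eval q H) := by
    rw [MvPolynomial.map_eval]
  obtain ⟨p, hp0, hp⟩ := exists_points_of_linearIndependent_functions
    (fun (j : Fin c) (q : Fin e' → ResidueField Q) =>
      MvPolynomial.eval q (MvPolynomial.map φ (F (Fin.castLE hcn j)))) (by
    intro u hu
    obtain ⟨v, rfl⟩ : ∃ v : Fin c → Q, u = φ ∘ v := by
      choose v hv using fun j => residue_surjective (u j)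
      exact ⟨v, funext fun j => (hv j).symm⟩
    have h0 : MvPolynomial.map φ (∑ j, MvPolynomial.C (v j) * F (Fin.castLE hcn j)) = 0 :=
      MvPolynomial.funext fun q => by simpa using hu q
    have hv : ∀ j, v j ∈ m := by
      by_contra! hv
      refine horder v hv ?_
      rw [← hcombx]
      refine (hcomb _ v).eval_mem_mul_pow hxm fun s => ?_
      rw [← hφm, ← MvPolynomial.coeff_map, h0, MvPolynomial.coeff_zero]
    exact funext fun j => (hφm _).mpr (hv j))
  obtain ⟨P, rfl⟩ : ∃ P : Fin c → Fin e' → Q, p = fun i => φ ∘ P i := by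
    choose P hP using fun i l => residue_surjective (p i l)
    exact ⟨P, funext fun i => funext fun l => (hP i l).symm⟩
  have hunit (i) : ∃ l, IsUnit (P i l) := by
    by_contra! h
    obtain ⟨j, hj⟩ := hp0 i
    refine hj ?_
    rw [hmapeval, hφm]
    have hmem := (Ideal.mem_span_pow_iff_exists_isHomogeneous (P i) _).mpr
      ⟨_, hF (Fin.castLE hcn j), rfl⟩
    refine Ideal.pow_le_self (by omega) (Ideal.pow_right_mono ?_ _ hmem)
    rw [Ideal.span_le]
    rintro _ ⟨l, rfl⟩
    exact h l
  choose l hl using hunit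
  choose r hr hle hvanish using fun i =>
    exists_isRegular_of_isUnit_apply hx hdim (P i) (hl i) (d := d) (by omega)
  have hkey (i) {s : ℕ} (g : Fin s → Fin n) (b : Fin s → Q)
      (hb : ∑ j, b j * f (g j) ∈ m * Ideal.span (Set.range (r i))) :
      ∑ j, φ (b j) * MvPolynomial.eval (φ ∘ P i) (MvPolynomial.map φ (F (g j))) = 0 := by
    have := (hφm _).mpr (hvanish i _ (hcomb g b) (by rwa [hcombx]))
    simpa [hmapeval] using this
  refine ⟨c, le_rfl, fun i => Ideal.span (Set.range (r i)), fun i => hId.trans (hle i),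
    fun i => ⟨r i, hr i, rfl⟩, fun i => isArtinianRing_quotient_of_maximalIdeal_pow_le (hle i),
    ?_, ?_⟩
  · rintro u ⟨j, hj⟩
    by_contra! h
    exact hj ((hφm _).mp (congrFun (hp (φ ∘ u) fun i => hkey i _ u (h i)) j))
  · obtain ⟨B, hB⟩ := exists_fin_basis_of_injective_submatrix (Fin.castLE hcn)
      (Fin.castLE_injective hcn)
      (fun i j => MvPolynomial.eval (φ ∘ P i) (MvPolynomial.map φ (F j))) hp
    choose W hW using fun j i => residue_surjective (B j i)
    refine ⟨fun j => ∑ i, W j i * f i, fun j => Ideal.sum_mem _ fun i _ =>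
      Ideal.mul_mem_left _ _ (hfI i), fun g hg hgJ => ?_⟩
    obtain ⟨b, rfl⟩ := Ideal.mem_span_range_iff_exists_fun.mp (hgen ▸ hg)
    obtain ⟨a, ha⟩ := hB (φ ∘ b) fun i => hkey i id b (hgJ i)
    choose a' ha' using fun j => residue_surjective (a j)
    refine ⟨a', ?_⟩
    have hsum : ∑ i, b i * f i - ∑ j, a' j * ∑ i, W j i * f i =
        ∑ i, (b i - ∑ j, a' j * W j i) * f i := by
      simp only [sub_mul, Finset.sum_sub_distrib, Finset.mul_sum, Finset.sum_mul, mul_assoc]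
      rw [Finset.sum_comm]
    rw [hsum]
    refine Ideal.sum_mem _ fun i _ => Ideal.mul_mem_mul ?_ (hfI i)
    rw [← hφm, map_sub, map_sum, sub_eq_zero]
    refine (ha i).trans (Finset.sum_congr rfl fun j _ => ?_)
    rw [map_mul, hφ, ha', hW]
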